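/- Let β ∈ (−1, 0). Then, as T → ∞, ∫_{{(x,z) ∈ [0,T]² : x+z ≥ T}} e^{z+x−2T} x^β z^β dx dz = T^{2β} − 2β·T^{2β−1} + β(3β−2)·T^{2β−2} + O(T^{2β−3}). -/

import Mathlib

open Real MeasureTheory

lemma intervalIntegrable_exp_mul_rpow {β : ℝ} (hβ : -1 < β) (T a b : ℝ) :
    IntervalIntegrable (fun x : ℝ => exp (x - T) * x ^ β) volume a b :=
  (intervalIntegral.intervalIntegrable_rpow' hβ).continuousOn_mul (by fun_prop)

lemma exp_neg_le_inv_pow_five {T : ℝ} (hT : 0 < T) : exp (-T) ≤ 120 * T⁻¹ ^ 5 := by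
  have h := Real.pow_div_factorial_le_exp T hT.le 5
  have h5 : ((Nat.factorial 5 : ℕ) : ℝ) = 120 := by norm_num [Nat.factorial]
  rw [h5] at h
  rw [exp_neg, inv_pow]
  calc (exp T)⁻¹ ≤ (T ^ 5 / 120)⁻¹ := inv_anti₀ (by positivity) h
    _ = 120 * (T ^ 5)⁻¹ := by field_simp

lemma rpow_le_rpow_mul_exp {γ x T : ℝ} (hγ : -4 ≤ γ) (hx : 1 ≤ x) (hxT : x ≤ T) :
    x ^ γ ≤ 4096 * T ^ γ * exp ((T - x) / 2) := by
  have hx0 : 0 < x := by linarith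
  have hT0 : 0 < T := by linarith
  have hq : 1 ≤ T / x := by rwa [le_div_iff₀ hx0, one_mul]
  have hq1 : T / x ≤ 1 + (T - x) := by
    rw [div_le_iff₀ hx0]; nlinarith
  have h1 : x ^ γ = T ^ γ * (T / x) ^ (-γ) := by
    rw [div_rpow hT0.le hx0.le, rpow_neg hT0.le, rpow_neg hx0.le]
    have := (rpow_pos_of_pos hx0 γ).ne'
    have := (rpow_pos_of_pos hT0 γ).ne'
    field_simp
  have h2 : (T / x) ^ (-γ) ≤ (T / x) ^ (4 : ℕ) := by
    rw [← rpow_natCast]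
    exact rpow_le_rpow_of_exponent_le hq (by push_cast; linarith)
  have h3 : 1 + (T - x) ≤ 8 * exp ((T - x) / 8) := by
    have := add_one_le_exp ((T - x) / 8)
    linarith
  have h4 : (T / x) ^ (4 : ℕ) ≤ (8 * exp ((T - x) / 8)) ^ 4 :=
    pow_le_pow_left₀ (by linarith) (hq1.trans h3) 4
  have h5 : (8 * exp ((T - x) / 8)) ^ 4 = 4096 * exp ((T - x) / 2) := by
    rw [mul_pow, ← exp_nat_mul]
    norm_num
    ring_nf
  rw [h1]
  calc T ^ γ * (T / x) ^ (-γ) ≤ T ^ γ * (4096 * exp ((T - x) / 2)) := by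
        gcongr
        linarith
    _ = _ := by ring

lemma integral_exp_mul_rpow_le {γ T : ℝ} (hγ : -4 ≤ γ) (hT : 1 ≤ T) :
    |∫ x in (1 : ℝ)..T, exp (x - T) * x ^ γ| ≤ 8192 * T ^ γ := by
  have hd : ∀ x ∈ Set.uIcc 1 T, HasDerivAt (fun x : ℝ => 8192 * T ^ γ * exp ((x - T) / 2))
      (4096 * T ^ γ * exp ((x - T) / 2)) x := by
    intro x _
    have h := ((((hasDerivAt_id x).sub_const T).div_const 2).exp).const_mul (8192 * T ^ γ)
    refine h.congr_deriv ?_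
    simp only [id]
    ring
  have hint : IntervalIntegrable (fun x : ℝ => 4096 * T ^ γ * exp ((x - T) / 2)) volume 1 T :=
    Continuous.intervalIntegrable (by fun_prop) _ _
  have hv := intervalIntegral.integral_eq_sub_of_hasDerivAt hd hint
  have hb := intervalIntegral.norm_integral_le_of_norm_le (μ := volume) hT
    (f := fun x : ℝ => exp (x - T) * x ^ γ)
    (g := fun x : ℝ => 4096 * T ^ γ * exp ((x - T) / 2))
    (Filter.Eventually.of_forall fun x hx => by
      have hx0 : 0 < x := by linarith [hx.1]
      rw [Real.norm_of_nonneg (by positivity)]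
      have h := rpow_le_rpow_mul_exp hγ hx.1.le hx.2
      have he : exp (x - T) * exp ((T - x) / 2) = exp ((x - T) / 2) := by
        rw [← exp_add]; ring_nf
      calc exp (x - T) * x ^ γ ≤ exp (x - T) * (4096 * T ^ γ * exp ((T - x) / 2)) := by gcongr
        _ = 4096 * T ^ γ * (exp (x - T) * exp ((T - x) / 2)) := by ring
        _ = _ := by rw [he]) hint
  rw [hv, Real.norm_eq_abs] at hb
  have hT0 : 0 < T := by linarith
  have hp : 0 ≤ 8192 * T ^ γ * exp ((1 - T) / 2) := by positivity
  simp only [sub_self, zero_div, exp_zero, mul_one] at hb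
  linarith

lemma integral_exp_mul_rpow_one_eq (β T : ℝ) (hT : 1 ≤ T) :
    ∫ x in (1 : ℝ)..T, exp (x - T) * x ^ β =
      (T ^ β - β * T ^ (β - 1) + β * (β - 1) * T ^ (β - 2)) -
        exp (1 - T) * (1 - β + β * (β - 1)) -
        β * (β - 1) * (β - 2) * ∫ x in (1 : ℝ)..T, exp (x - T) * x ^ (β - 3) := by
  have hint (γ : ℝ) : IntervalIntegrable (fun x : ℝ => exp (x - T) * x ^ γ) volume 1 T := by
    refine ContinuousOn.intervalIntegrable fun x hx => ContinuousAt.continuousWithinAt ?_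
    rw [Set.uIcc_of_le hT] at hx
    exact (by fun_prop : ContinuousAt (fun x : ℝ => exp (x - T)) x).mul
      (continuousAt_rpow_const _ _ (Or.inl (by linarith [hx.1])))
  have hd : ∀ x ∈ Set.uIcc 1 T, HasDerivAt
      (fun x : ℝ => exp (x - T) * (x ^ β - β * x ^ (β - 1) + β * (β - 1) * x ^ (β - 2)))
      (exp (x - T) * x ^ β + β * (β - 1) * (β - 2) * (exp (x - T) * x ^ (β - 3))) x := by
    intro x hx
    rw [Set.uIcc_of_le hT] at hx
    have hx0 : x ≠ 0 := by linarith [hx.1]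
    have hr (γ : ℝ) := hasDerivAt_rpow_const (x := x) (p := γ) (Or.inl hx0)
    have h := (((hasDerivAt_id x).sub_const T).exp).mul
      (((hr β).sub ((hr (β - 1)).const_mul β)).add ((hr (β - 2)).const_mul (β * (β - 1))))
    refine h.congr_deriv ?_
    simp only [id, Pi.add_apply, Pi.sub_apply]
    rw [show β - 1 - 1 = β - 2 by ring, show β - 2 - 1 = β - 3 by ring]
    ring
  have hv := intervalIntegral.integral_eq_sub_of_hasDerivAt hd
    ((hint β).add ((hint (β - 3)).const_mul _))
  rw [intervalIntegral.integral_add (hint β) ((hint (β - 3)).const_mul _),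
    intervalIntegral.integral_const_mul] at hv
  simp only [one_rpow, sub_self, exp_zero] at hv
  linarith

lemma rpow_sub_natCast_eq {T : ℝ} (hT : 0 < T) (a : ℝ) (n : ℕ) :
    T ^ (a - n) = T ^ a * T⁻¹ ^ n := by
  rw [rpow_sub hT, rpow_natCast, inv_pow, div_eq_mul_inv]

lemma abs_integral_exp_mul_rpow_zero_one_le {β : ℝ} (hβ : -1 < β) (T : ℝ) :
    |∫ x in (0 : ℝ)..1, exp (x - T) * x ^ β| ≤ exp (1 - T) / (β + 1) := by
  have hi : IntervalIntegrable (fun x : ℝ => exp (1 - T) * x ^ β) volume 0 1 :=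
    (intervalIntegral.intervalIntegrable_rpow' hβ).const_mul _
  have hb := intervalIntegral.norm_integral_le_of_norm_le (μ := volume) zero_le_one
    (f := fun x : ℝ => exp (x - T) * x ^ β)
    (Filter.Eventually.of_forall fun x hx => by
      have hx0 : 0 < x := hx.1
      rw [Real.norm_of_nonneg (by positivity)]
      have : x ≤ 1 := hx.2
      gcongr) hi
  rw [intervalIntegral.integral_const_mul, integral_rpow (Or.inl hβ), one_rpow,
    zero_rpow (by linarith), sub_zero, Real.norm_eq_abs] at hb
  linarith [mul_one_div (exp (1 - T)) (β + 1)]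

/-- Third-order expansion of `∫₀ᵀ exp (x - T) x ^ β dx`. -/
lemma exists_integral_exp_mul_rpow_expansion {β : ℝ} (hβ : β ∈ Set.Ioo (-1 : ℝ) 0) :
    ∃ K : ℝ, 0 ≤ K ∧ ∀ T > (1 : ℝ),
      |(∫ x in (0 : ℝ)..T, exp (x - T) * x ^ β) -
        T ^ β * (1 - β * T⁻¹ + β * (β - 1) * T⁻¹ ^ 2)| ≤ K * (T ^ β * T⁻¹ ^ 3) := by
  obtain ⟨hβ1, hβ0⟩ := hβ
  have hβ' : 0 < β + 1 := by linarith
  refine ⟨120 * exp 1 * (1 / (β + 1) + |1 - β + β * (β - 1)|) +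
    |β * (β - 1) * (β - 2)| * 8192, by positivity, fun T hT => ?_⟩
  have hT0 : 0 < T := by linarith
  have h3 := rpow_sub_natCast_eq hT0 β 3
  have h2 := rpow_sub_natCast_eq hT0 β 2
  have h1 := rpow_sub_natCast_eq hT0 β 1
  push_cast at h1 h2 h3
  have hH := integral_exp_mul_rpow_le (γ := β - 3) (by linarith) hT.le
  have hZ := abs_integral_exp_mul_rpow_zero_one_le hβ1 T
  have hE : exp (1 - T) ≤ 120 * exp 1 * (T ^ β * T⁻¹ ^ 3) := by
    have hs : T⁻¹ ≤ T ^ β := by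
      rw [← rpow_neg_one]; exact rpow_le_rpow_of_exponent_le hT.le hβ1.le
    have hs1 : T⁻¹ ≤ 1 := inv_le_one_of_one_le₀ hT.le
    have hs0 : 0 < T⁻¹ := inv_pos.mpr hT0
    have hk : T⁻¹ ^ 5 ≤ T ^ β * T⁻¹ ^ 3 :=
      calc T⁻¹ ^ 5 ≤ T⁻¹ ^ 4 := pow_le_pow_of_le_one hs0.le hs1 (by norm_num)
        _ = T⁻¹ * T⁻¹ ^ 3 := by ring
        _ ≤ _ := by gcongr
    rw [sub_eq_add_neg, exp_add]
    calc exp 1 * exp (-T) ≤ exp 1 * (120 * (T ^ β * T⁻¹ ^ 3)) := by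
          gcongr
          linarith [exp_neg_le_inv_pow_five hT0]
      _ = _ := by ring
  rw [← intervalIntegral.integral_add_adjacent_intervals
    (intervalIntegrable_exp_mul_rpow hβ1 T 0 1) (intervalIntegrable_exp_mul_rpow hβ1 T 1 T),
    integral_exp_mul_rpow_one_eq β T hT.le, h1, h2]
  rw [h3] at hH
  set Z := ∫ x in (0 : ℝ)..1, exp (x - T) * x ^ β
  set H := ∫ x in (1 : ℝ)..T, exp (x - T) * x ^ (β - 3)
  set w := T ^ β * T⁻¹ ^ 3
  have e : Z + (T ^ β - β * (T ^ β * T⁻¹ ^ 1) + β * (β - 1) * (T ^ β * T⁻¹ ^ 2) -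
      exp (1 - T) * (1 - β + β * (β - 1)) - β * (β - 1) * (β - 2) * H) -
      T ^ β * (1 - β * T⁻¹ + β * (β - 1) * T⁻¹ ^ 2) =
      Z - exp (1 - T) * (1 - β + β * (β - 1)) - β * (β - 1) * (β - 2) * H := by ring
  rw [e]
  calc _ ≤ |Z| + |exp (1 - T) * (1 - β + β * (β - 1))| + |β * (β - 1) * (β - 2) * H| :=
        (abs_sub _ _).trans (add_le_add_left (abs_sub _ _) _)
    _ ≤ exp (1 - T) / (β + 1) + exp (1 - T) * |1 - β + β * (β - 1)| +
        |β * (β - 1) * (β - 2)| * (8192 * w) := by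
        rw [abs_mul (exp (1 - T)), abs_of_pos (exp_pos _), abs_mul _ H]
        gcongr
    _ = exp (1 - T) * (1 / (β + 1) + |1 - β + β * (β - 1)|) +
        |β * (β - 1) * (β - 2)| * (8192 * w) := by ring
    _ ≤ 120 * exp 1 * w * (1 / (β + 1) + |1 - β + β * (β - 1)|) +
        |β * (β - 1) * (β - 2)| * (8192 * w) := by gcongr
    _ = _ := by ring

/-- Extending the truncated square to the full square costs only an exponentially small error. -/
lemma abs_setIntegral_sub_sq_le {β T : ℝ} (hβ : -1 < β) (hT : 0 ≤ T) :
    |(∫ p : ℝ × ℝ in {p : ℝ × ℝ | 0 ≤ p.1 ∧ p.1 ≤ T ∧ 0 ≤ p.2 ∧ p.2 ≤ T ∧ T ≤ p.1 + p.2},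
        exp (p.2 + p.1 - 2 * T) * p.1 ^ β * p.2 ^ β) -
      (∫ x in (0 : ℝ)..T, exp (x - T) * x ^ β) ^ 2| ≤
      exp (-T) * (T ^ (β + 1) / (β + 1)) ^ 2 := by
  set R := {p : ℝ × ℝ | 0 ≤ p.1 ∧ p.1 ≤ T ∧ 0 ≤ p.2 ∧ p.2 ≤ T ∧ T ≤ p.1 + p.2}
  set S : Set (ℝ × ℝ) := Set.Icc 0 T ×ˢ Set.Icc 0 T
  have hRS : R ⊆ S := fun p ⟨h1, h2, h3, h4, _⟩ => ⟨⟨h1, h2⟩, ⟨h3, h4⟩⟩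
  have hS : MeasurableSet S := measurableSet_Icc.prod measurableSet_Icc
  have hR : MeasurableSet R := by
    refine IsClosed.measurableSet ?_
    simp only [R, Set.ofPred_and]
    refine ((isClosed_le ?_ ?_).inter ((isClosed_le ?_ ?_).inter ((isClosed_le ?_ ?_).inter
      ((isClosed_le ?_ ?_).inter (isClosed_le ?_ ?_))))) <;> fun_prop
  have hf : IntegrableOn (fun x : ℝ => exp (x - T) * x ^ β) (Set.Icc 0 T) :=
    (intervalIntegrable_iff_integrableOn_Icc_of_le hT).1 (intervalIntegrable_exp_mul_rpow hβ T 0 T)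
  have hg : IntegrableOn (fun x : ℝ => x ^ β) (Set.Icc 0 T) :=
    (intervalIntegrable_iff_integrableOn_Icc_of_le hT).1
      (intervalIntegral.intervalIntegrable_rpow' hβ)
  have hF : (fun p : ℝ × ℝ => exp (p.2 + p.1 - 2 * T) * p.1 ^ β * p.2 ^ β) =
      fun p => (exp (p.1 - T) * p.1 ^ β) * (exp (p.2 - T) * p.2 ^ β) := by
    funext p
    rw [show p.2 + p.1 - 2 * T = (p.1 - T) + (p.2 - T) by ring, exp_add]
    ring
  have hFS : IntegrableOn
      (fun p : ℝ × ℝ => exp (p.2 + p.1 - 2 * T) * p.1 ^ β * p.2 ^ β) S := by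
    rw [hF, IntegrableOn, Measure.volume_eq_prod, ← Measure.prod_restrict]
    exact hf.mul_prod hf
  have hGS : IntegrableOn (fun p : ℝ × ℝ => exp (-T) * (p.1 ^ β * p.2 ^ β)) S := by
    rw [IntegrableOn, Measure.volume_eq_prod, ← Measure.prod_restrict]
    exact (hg.mul_prod hg).const_mul _
  have hFv : ∫ p in S, exp (p.2 + p.1 - 2 * T) * p.1 ^ β * p.2 ^ β =
      (∫ x in (0 : ℝ)..T, exp (x - T) * x ^ β) ^ 2 := by
    rw [hF, Measure.volume_eq_prod, setIntegral_prod_mul (fun x : ℝ => exp (x - T) * x ^ β)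
        (fun x : ℝ => exp (x - T) * x ^ β), integral_Icc_eq_integral_Ioc,
      ← intervalIntegral.integral_of_le hT, sq]
  have hGv : ∫ p in S, exp (-T) * (p.1 ^ β * p.2 ^ β) =
      exp (-T) * (T ^ (β + 1) / (β + 1)) ^ 2 := by
    rw [integral_const_mul, Measure.volume_eq_prod,
      setIntegral_prod_mul (fun x : ℝ => x ^ β) (fun x : ℝ => x ^ β),
      integral_Icc_eq_integral_Ioc,
      ← intervalIntegral.integral_of_le hT, integral_rpow (Or.inl hβ),
      zero_rpow (by linarith), sub_zero, sq]
  have hsplit := setIntegral_sdiff (μ := volume) hR hFS hRS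
  rw [← hFv, abs_sub_comm, ← hsplit, ← Real.norm_eq_abs, ← hGv]
  refine (norm_integral_le_of_norm_le (hGS.mono_set Set.sdiff_subset) ?_).trans
    (setIntegral_mono_set hGS ?_ Set.sdiff_subset.eventuallyLE)
  · refine (ae_restrict_iff' (hS.diff hR)).2 (Filter.Eventually.of_forall ?_)
    rintro p ⟨⟨⟨h1, h2⟩, ⟨h3, h4⟩⟩, hn⟩
    have hlt : p.1 + p.2 < T := by
      by_contra! h
      exact hn ⟨h1, h2, h3, h4, h⟩
    have := rpow_nonneg h1 β
    have := rpow_nonneg h3 β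
    rw [Real.norm_of_nonneg (by positivity), mul_assoc]
    gcongr
    linarith
  · refine (ae_restrict_iff' hS).2 (Filter.Eventually.of_forall ?_)
    rintro p ⟨⟨h1, _⟩, ⟨h3, _⟩⟩
    have := rpow_nonneg h1 β
    have := rpow_nonneg h3 β
    simp only [Pi.zero_apply]
    positivity

theorem stmt_12 (β : ℝ) (hβ : β ∈ Set.Ioo (-1 : ℝ) 0) :
    ∃ M c : ℝ, ∀ T > c,
      |(∫ p : ℝ × ℝ in {p : ℝ × ℝ | 0 ≤ p.1 ∧ p.1 ≤ T ∧ 0 ≤ p.2 ∧ p.2 ≤ T ∧ T ≤ p.1 + p.2},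
            Real.exp (p.2 + p.1 - 2 * T) * p.1 ^ β * p.2 ^ β) -
          (T ^ (2 * β) - 2 * β * T ^ (2 * β - 1) + β * (3 * β - 2) * T ^ (2 * β - 2))|
        ≤ M * T ^ (2 * β - 3) := by
  obtain ⟨K, hK, hA⟩ := exists_integral_exp_mul_rpow_expansion hβ
  obtain ⟨hβ1, hβ0⟩ := hβ
  have hβ' : 0 < β + 1 := by linarith
  refine ⟨120 / (β + 1) ^ 2 + (8 + 8 * K + K ^ 2), 1, fun T hT => ?_⟩
  have hT0 : 0 < T := by linarith
  have hB := abs_setIntegral_sub_sq_le hβ1 hT0.le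
  specialize hA T hT
  have h0 : T ^ (2 * β) = (T ^ β) ^ 2 := by rw [mul_comm, rpow_mul hT0.le, rpow_two]
  have h3 := rpow_sub_natCast_eq hT0 (2 * β) 3
  have h2 := rpow_sub_natCast_eq hT0 (2 * β) 2
  have h1 := rpow_sub_natCast_eq hT0 (2 * β) 1
  push_cast at h1 h2 h3
  have hE : exp (-T) * (T ^ (β + 1) / (β + 1)) ^ 2 ≤
      120 / (β + 1) ^ 2 * ((T ^ β) ^ 2 * T⁻¹ ^ 3) := by
    calc exp (-T) * (T ^ (β + 1) / (β + 1)) ^ 2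
        ≤ 120 * T⁻¹ ^ 5 * (T ^ (β + 1) / (β + 1)) ^ 2 := by
          gcongr
          exact exp_neg_le_inv_pow_five hT0
      _ = _ := by
          rw [rpow_add_one hT0.ne']
          field_simp
  rw [h1, h2, h3, h0]
  have ht : 0 < T ^ β := rpow_pos_of_pos hT0 β
  have hs0 : 0 < T⁻¹ := inv_pos.mpr hT0
  have hs1 : T⁻¹ ≤ 1 := inv_le_one_of_one_le₀ hT.le
  generalize (∫ p : ℝ × ℝ in _, Real.exp (p.2 + p.1 - 2 * T) * p.1 ^ β * p.2 ^ β) = I at *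
  generalize (∫ x in (0 : ℝ)..T, exp (x - T) * x ^ β) = A at *
  generalize T ^ β = t at *
  generalize T⁻¹ = s at *
  set q := 1 - β * s + β * (β - 1) * s ^ 2 with hq
  have hs2 : s ^ 2 ≤ 1 := pow_le_one₀ hs0.le hs1
  have hs3 : s ^ 3 ≤ 1 := pow_le_one₀ hs0.le hs1
  have hc0 : 0 ≤ β * (β - 1) := by nlinarith
  have hc2 : β * (β - 1) ≤ 2 := by nlinarith
  have hq0 : 0 ≤ q := by nlinarith [sq_nonneg s, mul_nonneg hc0 (sq_nonneg s)]
  have hq4 : q ≤ 4 := by nlinarith [mul_le_mul hc2 hs2 (sq_nonneg s) (by norm_num)]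
  have hw : 0 ≤ t ^ 2 * s ^ 3 := by positivity
  set e := A - t * q with he
  have hmain : |A ^ 2 - (t ^ 2 - 2 * β * (t ^ 2 * s ^ 1) + β * (3 * β - 2) * (t ^ 2 * s ^ 2))| ≤
      (8 + 8 * K + K ^ 2) * (t ^ 2 * s ^ 3) := by
    have hr : A ^ 2 - (t ^ 2 - 2 * β * (t ^ 2 * s ^ 1) + β * (3 * β - 2) * (t ^ 2 * s ^ 2)) =
        (-2 * β * (β * (β - 1)) + (β * (β - 1)) ^ 2 * s) * (t ^ 2 * s ^ 3) +
          (2 * t * q * e + e ^ 2) := by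
      rw [he, hq]; ring
    have hu : |(-2 * β * (β * (β - 1)) + (β * (β - 1)) ^ 2 * s) * (t ^ 2 * s ^ 3)| ≤
        8 * (t ^ 2 * s ^ 3) := by
      rw [abs_mul, abs_of_nonneg hw]
      gcongr
      generalize β * (β - 1) = b at *
      rw [abs_of_nonneg (by have : 0 ≤ -2 * β := by linarith
                            positivity)]
      have hb2 : b ^ 2 ≤ 4 := by nlinarith
      nlinarith [mul_nonneg hc0 (by linarith : 0 ≤ 1 + β),
        mul_nonneg (sq_nonneg b) (by linarith : 0 ≤ 1 - s)]
    have hv : |2 * t * q * e| ≤ 8 * K * (t ^ 2 * s ^ 3) := by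
      rw [abs_mul, abs_of_nonneg (by positivity : 0 ≤ 2 * t * q)]
      calc 2 * t * q * |e| ≤ 2 * t * 4 * (K * (t * s ^ 3)) := by gcongr
        _ = _ := by ring
    have hx : |e ^ 2| ≤ K ^ 2 * (t ^ 2 * s ^ 3) := by
      rw [abs_pow]
      calc |e| ^ 2 ≤ (K * (t * s ^ 3)) ^ 2 := by gcongr
        _ = K ^ 2 * (t ^ 2 * s ^ 3) * s ^ 3 := by ring
        _ ≤ _ := mul_le_of_le_one_right (by positivity) hs3
    rw [hr]
    refine (abs_add_le _ _).trans ?_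
    have := abs_add_le (2 * t * q * e) (e ^ 2)
    linarith
  have := abs_sub_le I (A ^ 2)
    (t ^ 2 - 2 * β * (t ^ 2 * s ^ 1) + β * (3 * β - 2) * (t ^ 2 * s ^ 2))
  linarith
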